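/- There exist six pairwise distinct geodesic lines γ₁,…,γ₆ in the hyperbolic plane ℍ² such that: γ₁,…,γ₅ form a right-angled pentagon (consecutive lines meet orthogonally, non-consecutive ones are disjoint), γ₆ meets γ₁ orthogonally and is disjoint from γ₂,…,γ₅, and the group generated by the reflections across γ₁,…,γ₆ is not discrete. In particular, γ₁,…,γ₆ cannot be the walls of a discrete reflection group acting on ℍ². -/

import Mathlib

open Real Set Metric

noncomputable section

/-- `γ` restricted to the parameter set `s` is an isometric (unit-speed) embedding. -/
def IsGeodesicOn {X : Type*} [MetricSpace X] (γ : ℝ → X) (s : Set ℝ) : Prop :=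
  ∀ a ∈ s, ∀ b ∈ s, dist (γ a) (γ b) = |a - b|

/-- A geodesic segment parametrized on `[a,b]` from `x` to `y`. -/
def IsGeodesicSeg {X : Type*} [MetricSpace X] (γ : ℝ → X) (a b : ℝ) (x y : X) : Prop :=
  IsGeodesicOn γ (Set.Icc a b) ∧ γ a = x ∧ γ b = y

/-- A local geodesic parametrized on `[a,b]`. -/
def IsLocalGeodesic {X : Type*} [MetricSpace X] (γ : ℝ → X) (a b : ℝ) : Prop :=
  ∀ t ∈ Set.Icc a b, ∃ ε > 0, IsGeodesicOn γ (Set.Icc (t - ε) (t + ε) ∩ Set.Icc a b)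

/-- Any two points are joined by a geodesic. -/
def GeodesicSpace (X : Type*) [MetricSpace X] : Prop :=
  ∀ x y : X, ∃ γ : ℝ → X, IsGeodesicSeg γ 0 (dist x y) x y

/-- The distance in the unit 2-sphere from the vertex `P̄` of a spherical comparison
triangle with side lengths `a = d(Q,R)`, `b = d(R,P)`, `c = d(P,Q)` to the point at
arclength `t` along the side `Q̄R̄` (spherical law of cosines). -/
def sphCompDist (a b c t : ℝ) : ℝ :=
  Real.arccos (Real.cos c * Real.cos t +
    Real.sin c * Real.sin t *
      ((Real.cos b - Real.cos a * Real.cos c) / (Real.sin a * Real.sin c)))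

/-- CAT(1): distances < π are realized by geodesics, and geodesic triangles of
perimeter < 2π are at least as thin as their comparison triangles in the unit sphere. -/
def IsCAT1 (X : Type*) [MetricSpace X] : Prop :=
  (∀ x y : X, dist x y < π → ∃ γ : ℝ → X, IsGeodesicSeg γ 0 (dist x y) x y) ∧
  ∀ (p q r : X) (γ : ℝ → X), IsGeodesicSeg γ 0 (dist q r) q r →
    dist p q + dist q r + dist r p < 2 * π →
    ∀ t ∈ Set.Icc (0:ℝ) (dist q r),
      dist p (γ t) ≤ sphCompDist (dist q r) (dist r p) (dist p q) t

/-- CAT(0): geodesic space satisfying the CN (midpoint) comparison inequality. -/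
def IsCAT0 (X : Type*) [MetricSpace X] : Prop :=
  GeodesicSpace X ∧
  ∀ p q r m : X, dist q m = dist q r / 2 → dist m r = dist q r / 2 →
    dist p m ^ 2 ≤ (dist p q ^ 2 + dist p r ^ 2) / 2 - dist q r ^ 2 / 4

/-- Euclidean comparison angle at `x` of the points `p`, `q`. -/
def compAngle {X : Type*} [MetricSpace X] (x p q : X) : ℝ :=
  Real.arccos ((dist x p ^ 2 + dist x q ^ 2 - dist p q ^ 2) / (2 * dist x p * dist x q))

/-- The Alexandrov (upper) angle at `x` between two curves `γ`, `σ` emanating from `x`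
(parametrized with `γ 0 = σ 0 = x`). -/
def alexAngle {X : Type*} [MetricSpace X] (x : X) (γ σ : ℝ → X) : ℝ :=
  ⨅ ε : {ε : ℝ // 0 < ε}, ⨆ s ∈ Set.Ioc (0:ℝ) ε.1, ⨆ t ∈ Set.Ioc (0:ℝ) ε.1,
    compAngle x (γ s) (σ t)

/-- Two complete geodesics meet orthogonally: they intersect at a point where the
Alexandrov angle between (suitably based reparametrizations of) them is π/2. -/
def MeetOrtho (γ σ : ℝ → UpperHalfPlane) : Prop :=
  ∃ s t : ℝ, γ s = σ t ∧
    alexAngle (γ s) (fun u => γ (s + u)) (fun u => σ (t + u)) = π / 2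

/-- Two complete geodesics are disjoint. -/
def DisjLines (γ σ : ℝ → UpperHalfPlane) : Prop :=
  Set.range γ ∩ Set.range σ = ∅

/-- `ρ` is the reflection across the geodesic line `γ`: a nontrivial involutive isometry
fixing `γ` pointwise. -/
def IsReflAcross (ρ : UpperHalfPlane ≃ᵢ UpperHalfPlane) (γ : ℝ → UpperHalfPlane) : Prop :=
  ρ ≠ IsometryEquiv.refl UpperHalfPlane ∧
  ρ.trans ρ = IsometryEquiv.refl UpperHalfPlane ∧
  ∀ t : ℝ, ρ (γ t) = γ t

/-- Inclusion `Fin 5 → Fin 6`. -/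
def pent (i : Fin 5) : Fin 6 := ⟨i.1, by omega⟩

/-! ### Hyperbolic trigonometry -/

lemma aux_cosh_inj {a b : ℝ} (ha : 0 ≤ a) (hb : 0 ≤ b) (h : Real.cosh a = Real.cosh b) : a = b :=
  Real.cosh_injOn ha hb h

lemma aux_powers (u v : ℝ) (hv : 0 ≤ v) (hvu : v ≤ u) (huv : u + v ≤ 1) (n : ℕ) :
    (0 ≤ (u + v) ^ n - (u - v) ^ n ∧ (u + v) ^ n - (u - v) ^ n ≤ 2 * n * v) ∧
    (0 ≤ (u + v) ^ n + (u - v) ^ n - 2 * u ^ n ∧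
      (u + v) ^ n + (u - v) ^ n - 2 * u ^ n ≤ (n : ℝ) ^ 2 * v ^ 2) := by
  have hu : 0 ≤ u := hv.trans hvu
  have hu1 : u ≤ 1 := by linarith
  induction n with
  | zero => norm_num
  | succ n ih =>
    obtain ⟨⟨h1, h2⟩, h3, h4⟩ := ih
    have p1 : 0 ≤ (u + v) ^ n := by positivity
    have p2 : 0 ≤ (u - v) ^ n := pow_nonneg (by linarith) n
    have p3 : (u + v) ^ n ≤ 1 := pow_le_one₀ (by linarith) huv
    have p4 : (u - v) ^ n ≤ 1 := pow_le_one₀ (by linarith) (by linarith)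
    have e1 : (u + v) ^ (n + 1) - (u - v) ^ (n + 1)
        = u * ((u + v) ^ n - (u - v) ^ n) + v * ((u + v) ^ n + (u - v) ^ n) := by ring
    have e2 : (u + v) ^ (n + 1) + (u - v) ^ (n + 1) - 2 * u ^ (n + 1)
        = u * ((u + v) ^ n + (u - v) ^ n - 2 * u ^ n) + v * ((u + v) ^ n - (u - v) ^ n) := by ring
    rw [e1, e2]
    push_cast
    refine ⟨⟨by positivity, ?_⟩, by positivity, ?_⟩
    · have := mul_le_of_le_one_left h1 hu1
      have := mul_le_mul_of_nonneg_left (add_le_add p3 p4) hv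
      linarith
    · have := mul_le_of_le_one_left h3 hu1
      have := mul_le_mul_of_nonneg_left h2 hv
      nlinarith [sq_nonneg v]

/-- Comparison of a small hyperbolic right triangle with the Euclidean one. -/
lemma aux_right_triangle {s t d : ℝ} (hs : 0 < s) (ht : 0 < t) (hst : s + t ≤ 1) (hd : 0 ≤ d)
    (h : Real.cosh d = Real.cosh s * Real.cosh t) :
    s ^ 2 + t ^ 2 ≤ d ^ 2 ∧ d ^ 2 ≤ s ^ 2 + t ^ 2 + 4 * Real.cosh 2 * s ^ 2 * t ^ 2 := by
  set w := √(s ^ 2 + t ^ 2) with hw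
  have hw2 : w ^ 2 = s ^ 2 + t ^ 2 := Real.sq_sqrt (by positivity)
  have hw0 : 0 ≤ w := Real.sqrt_nonneg _
  have hsum := ((Real.hasSum_cosh (s + t)).add (Real.hasSum_cosh (s - t))).sub
    ((Real.hasSum_cosh w).mul_left 2)
  have hval : Real.cosh (s + t) + Real.cosh (s - t) - 2 * Real.cosh w
      = 2 * (Real.cosh d - Real.cosh w) := by
    rw [h, Real.cosh_add, Real.cosh_sub]; ring
  rw [hval] at hsum
  have hp := aux_powers (s ^ 2 + t ^ 2) (2 * s * t) (by positivity)
    (by nlinarith [sq_nonneg (s - t)]) (by nlinarith)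
  have hterm : ∀ n : ℕ, (s + t) ^ (2 * n) / ((2 * n).factorial : ℝ)
      + (s - t) ^ (2 * n) / ((2 * n).factorial : ℝ)
      - 2 * (w ^ (2 * n) / ((2 * n).factorial : ℝ))
      = ((s ^ 2 + t ^ 2 + 2 * s * t) ^ n + (s ^ 2 + t ^ 2 - 2 * s * t) ^ n
        - 2 * (s ^ 2 + t ^ 2) ^ n) / ((2 * n).factorial : ℝ) := by
    intro n
    rw [pow_mul, pow_mul, pow_mul, hw2,
      show (s + t) ^ 2 = s ^ 2 + t ^ 2 + 2 * s * t by ring,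
      show (s - t) ^ 2 = s ^ 2 + t ^ 2 - 2 * s * t by ring]
    ring
  have hlow : 0 ≤ 2 * (Real.cosh d - Real.cosh w) := by
    refine hsum.nonneg (fun n => ?_)
    rw [hterm]
    exact div_nonneg (hp n).2.1 (by positivity)
  have hup : 2 * (Real.cosh d - Real.cosh w) ≤ (2 * s * t) ^ 2 * Real.cosh 2 := by
    refine hasSum_le (fun n => ?_) hsum ((Real.hasSum_cosh 2).mul_left _)
    rw [hterm, ← mul_div_assoc]
    refine div_le_div_of_nonneg_right ((hp n).2.2.trans ?_) (by positivity)
    rw [mul_comm]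
    refine mul_le_mul_of_nonneg_left ?_ (by positivity)
    have : (n : ℝ) ≤ 2 ^ n := by exact_mod_cast Nat.lt_two_pow_self.le
    calc (n : ℝ) ^ 2 ≤ (2 ^ n) ^ 2 := by gcongr
      _ = 2 ^ (2 * n) := by rw [← pow_mul, mul_comm]
  have hwd : w ≤ d := by
    have : Real.cosh w ≤ Real.cosh d := by linarith
    rw [Real.cosh_le_cosh, abs_of_nonneg hw0, abs_of_nonneg hd] at this
    exact this
  have hdiff : Real.cosh d - Real.cosh w = 2 * Real.sinh ((d + w) / 2) * Real.sinh ((d - w) / 2) := by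
    have e1 : d = (d + w) / 2 + (d - w) / 2 := by ring
    have e2 : w = (d + w) / 2 - (d - w) / 2 := by ring
    conv_lhs => rw [e1]
    have : Real.cosh w = Real.cosh ((d + w) / 2 - (d - w) / 2) := by rw [← e2]
    rw [this, Real.cosh_add, Real.cosh_sub]; ring
  have h1 : (d + w) / 2 ≤ Real.sinh ((d + w) / 2) := Real.self_le_sinh_iff.2 (by linarith)
  have h2 : (d - w) / 2 ≤ Real.sinh ((d - w) / 2) := Real.self_le_sinh_iff.2 (by linarith)
  have h3 : (d + w) / 2 * ((d - w) / 2) ≤ Real.sinh ((d + w) / 2) * Real.sinh ((d - w) / 2) :=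
    mul_le_mul h1 h2 (by linarith) (by linarith)
  constructor
  · rw [← hw2]; gcongr
  · nlinarith

/-! ### Orthogonality -/

/-- Pythagoras holds along two lines. -/
def PythOrtho (γ σ : ℝ → UpperHalfPlane) : Prop :=
  ∃ s t : ℝ, ∀ a b : ℝ,
    Real.cosh (dist (γ (s + a)) (σ (t + b))) = Real.cosh a * Real.cosh b

lemma PythOrtho.symm {γ σ : ℝ → UpperHalfPlane} (h : PythOrtho γ σ) : PythOrtho σ γ := by
  obtain ⟨s, t, h⟩ := h
  exact ⟨t, s, fun a b => by rw [dist_comm, h, mul_comm]⟩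

lemma PythOrtho.range_ne {γ σ : ℝ → UpperHalfPlane} (h : PythOrtho γ σ) :
    Set.range γ ≠ Set.range σ := by
  obtain ⟨s, t, h⟩ := h
  intro he
  have : γ (s + 1) ∈ Set.range σ := he ▸ ⟨_, rfl⟩
  obtain ⟨b, hb⟩ := this
  have h1 := h 1 (b - t)
  rw [add_sub_cancel, hb, dist_self, Real.cosh_zero] at h1
  have h2 : 1 < Real.cosh 1 := Real.one_lt_cosh.2 one_ne_zero
  have h3 := Real.one_le_cosh (b - t)
  nlinarith

lemma compAngle_nonneg' {X : Type*} [MetricSpace X] (x p q : X) : 0 ≤ compAngle x p q :=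
  Real.arccos_nonneg _

lemma compAngle_le_pi' {X : Type*} [MetricSpace X] (x p q : X) : compAngle x p q ≤ π :=
  Real.arccos_le_pi _

lemma PythOrtho.meetOrtho {γ σ : ℝ → UpperHalfPlane} (hγ : IsGeodesicOn γ Set.univ)
    (hσ : IsGeodesicOn σ Set.univ) (h : PythOrtho γ σ) : MeetOrtho γ σ := by
  obtain ⟨s, t, h⟩ := h
  have hpt : γ s = σ t := by
    have := h 0 0
    rw [add_zero, add_zero, Real.cosh_zero, mul_one] at this
    exact dist_eq_zero.1 (aux_cosh_inj dist_nonneg le_rfl (by rw [this, Real.cosh_zero]))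
  refine ⟨s, t, hpt, ?_⟩
  have hang : ∀ a b : ℝ, 0 < a → 0 < b → a + b ≤ 1 →
      π / 2 ≤ compAngle (γ s) (γ (s + a)) (σ (t + b)) ∧
      compAngle (γ s) (γ (s + a)) (σ (t + b)) ≤ Real.arccos (-(2 * Real.cosh 2 * (a * b))) := by
    intro a b ha hb hab
    have d1 : dist (γ s) (γ (s + a)) = a := by
      rw [hγ _ trivial _ trivial, show s - (s + a) = -a by ring, abs_neg, abs_of_pos ha]
    have d2 : dist (γ s) (σ (t + b)) = b := by
      rw [hpt, hσ _ trivial _ trivial, show t - (t + b) = -b by ring, abs_neg, abs_of_pos hb]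
    obtain ⟨k1, k2⟩ := aux_right_triangle ha hb hab dist_nonneg (h a b)
    unfold compAngle
    rw [d1, d2]
    have hab0 : 0 < 2 * a * b := by positivity
    constructor
    · rw [← Real.arccos_zero]
      apply Real.arccos_le_arccos
      exact div_nonpos_of_nonpos_of_nonneg (by linarith) hab0.le
    · apply Real.arccos_le_arccos
      rw [le_div_iff₀ hab0]
      nlinarith
  set f : ℝ → ℝ → ℝ := fun a b => compAngle (γ s) (γ (s + a)) (σ (t + b)) with hf
  have f0 : ∀ a b, 0 ≤ f a b := fun a b => compAngle_nonneg' _ _ _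
  have fpi : ∀ a b, f a b ≤ π := fun a b => compAngle_le_pi' _ _ _
  change (⨅ ε : {ε : ℝ // 0 < ε}, ⨆ a ∈ Set.Ioc (0:ℝ) ε.1, ⨆ b ∈ Set.Ioc (0:ℝ) ε.1, f a b) = π / 2
  have hlow : ∀ ε : {ε : ℝ // 0 < ε},
      π / 2 ≤ ⨆ a ∈ Set.Ioc (0:ℝ) ε.1, ⨆ b ∈ Set.Ioc (0:ℝ) ε.1, f a b := by
    intro ε
    have hm : min ε.1 (1/2) ∈ Set.Ioc (0:ℝ) ε.1 :=
      ⟨lt_min ε.2 (by norm_num), min_le_left _ _⟩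
    have hm2 : min ε.1 (1/2) ≤ 1/2 := min_le_right _ _
    have hpi := Real.pi_pos.le
    have B1 : ∀ a, (⨆ b ∈ Set.Ioc (0:ℝ) ε.1, f a b) ≤ π := fun a =>
      Real.iSup_le (fun b => Real.iSup_le (fun _ => fpi a b) hpi) hpi
    refine le_ciSup_of_le (c := min ε.1 (1/2))
      ⟨π, by rintro _ ⟨a, rfl⟩; exact Real.iSup_le (fun _ => B1 a) hpi⟩ ?_
    refine le_ciSup_of_le (c := hm) ⟨π, by rintro _ ⟨_, rfl⟩; exact B1 _⟩ ?_
    refine le_ciSup_of_le (c := min ε.1 (1/2))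
      ⟨π, by rintro _ ⟨b, rfl⟩; exact Real.iSup_le (fun _ => fpi _ b) hpi⟩ ?_
    refine le_ciSup_of_le (c := hm) ⟨π, by rintro _ ⟨_, rfl⟩; exact fpi _ _⟩ ?_
    exact (hang _ _ hm.1 hm.1 (by linarith)).1
  have : Nonempty {ε : ℝ // 0 < ε} := ⟨⟨1, one_pos⟩⟩
  refine le_antisymm ?_ (le_ciInf hlow)
  -- upper bound: a limit argument
  have hcont : Filter.Tendsto (fun ε : ℝ => Real.arccos (-(2 * Real.cosh 2 * (ε * ε))))
      (nhdsWithin 0 (Set.Ioi 0)) (nhds (π / 2)) := by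
    have hc : Continuous (fun ε : ℝ => Real.arccos (-(2 * Real.cosh 2 * (ε * ε)))) :=
      Real.continuous_arccos.comp (by fun_prop)
    have := hc.tendsto 0
    simp only [mul_zero, neg_zero, Real.arccos_zero] at this
    exact this.mono_left nhdsWithin_le_nhds
  refine ge_of_tendsto hcont ?_
  have hev : ∀ᶠ ε : ℝ in nhdsWithin 0 (Set.Ioi 0), ε ∈ Set.Ioc (0:ℝ) (1/2) :=
    Ioc_mem_nhdsGT (by norm_num)
  filter_upwards [hev] with ε hε
  refine ciInf_le_of_le ⟨π / 2, by rintro _ ⟨e, rfl⟩; exact hlow e⟩ ⟨ε, hε.1⟩ ?_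
  have hnn := Real.arccos_nonneg (-(2 * Real.cosh 2 * (ε * ε)))
  refine Real.iSup_le (fun a => Real.iSup_le (fun ha => Real.iSup_le (fun b =>
    Real.iSup_le (fun hb => ?_) hnn) hnn) hnn) hnn
  simp only [Set.mem_Ioc] at ha hb hε
  refine (hang a b ha.1 hb.1 (by linarith)).2.trans (Real.arccos_le_arccos ?_)
  have : a * b ≤ ε * ε := mul_le_mul ha.2 hb.2 hb.1.le hε.1.le
  have hc := Real.cosh_pos 2
  nlinarith

/-! ### Lines and reflections in coordinates -/

/-- The point with given coordinates. -/
def hpt (x y : ℝ) (hy : 0 < y) : UpperHalfPlane := ⟨⟨x, y⟩, hy⟩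

lemma cosh_dist_coord (z w : UpperHalfPlane) :
    Real.cosh (dist z w) =
      ((z.re - w.re) ^ 2 + z.im ^ 2 + w.im ^ 2) / (2 * z.im * w.im) := by
  rw [UpperHalfPlane.cosh_dist']

/-- A self-inverse pair of maps preserving the coordinate distance is an isometry. -/
def mkIso (f g : UpperHalfPlane → UpperHalfPlane) (hfg : ∀ z, f (g z) = z)
    (hgf : ∀ z, g (f z) = z)
    (h : ∀ z w, Real.cosh (dist (f z) (f w)) = Real.cosh (dist z w)) :
    UpperHalfPlane ≃ᵢ UpperHalfPlane where
  toFun := f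
  invFun := g
  left_inv := hgf
  right_inv := hfg
  isometry_toFun := Isometry.of_dist_eq fun z w =>
    aux_cosh_inj dist_nonneg dist_nonneg (h z w)

lemma circ_den_pos (c : ℝ) (z : UpperHalfPlane) : 0 < (z.re - c) ^ 2 + z.im ^ 2 := by
  have := z.im_pos
  positivity

/-- inversion in the circle with centre `c` and radius `r` -/
def inv0 (c r : ℝ) (hr : 0 < r) (z : UpperHalfPlane) : UpperHalfPlane :=
  hpt (c + r ^ 2 * (z.re - c) / ((z.re - c) ^ 2 + z.im ^ 2))
    (r ^ 2 * z.im / ((z.re - c) ^ 2 + z.im ^ 2))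
    (div_pos (mul_pos (pow_pos hr 2) z.im_pos) (circ_den_pos c z))

lemma inv0_re (c r : ℝ) (hr : 0 < r) (z : UpperHalfPlane) :
    (inv0 c r hr z).re = c + r ^ 2 * (z.re - c) / ((z.re - c) ^ 2 + z.im ^ 2) := rfl

lemma inv0_im (c r : ℝ) (hr : 0 < r) (z : UpperHalfPlane) :
    (inv0 c r hr z).im = r ^ 2 * z.im / ((z.re - c) ^ 2 + z.im ^ 2) := rfl

lemma inv0_inv0 (c r : ℝ) (hr : 0 < r) (z : UpperHalfPlane) :
    inv0 c r hr (inv0 c r hr z) = z := by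
  have hD := circ_den_pos c z
  have hy := z.im_pos
  have key : (r ^ 2 * (z.re - c) / ((z.re - c) ^ 2 + z.im ^ 2)) ^ 2 +
      (r ^ 2 * z.im / ((z.re - c) ^ 2 + z.im ^ 2)) ^ 2 = r ^ 4 / ((z.re - c) ^ 2 + z.im ^ 2) := by
    field_simp
  apply UpperHalfPlane.ext_re_im
  · rw [inv0_re, inv0_re, inv0_im, add_sub_cancel_left, key]
    field_simp
    ring
  · rw [inv0_im, inv0_re, inv0_im, add_sub_cancel_left, key]
    field_simp

lemma inv0_dist (c r : ℝ) (hr : 0 < r) (z w : UpperHalfPlane) :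
    Real.cosh (dist (inv0 c r hr z) (inv0 c r hr w)) = Real.cosh (dist z w) := by
  have hD := circ_den_pos c z
  have hE := circ_den_pos c w
  have hy := z.im_pos
  have hy' := w.im_pos
  rw [cosh_dist_coord, cosh_dist_coord, inv0_re, inv0_re, inv0_im, inv0_im]
  obtain ⟨p, hp⟩ : ∃ p, p = z.re - c := ⟨_, rfl⟩
  obtain ⟨q, hq⟩ : ∃ q, q = w.re - c := ⟨_, rfl⟩
  rw [show z.re - w.re = p - q by rw [hp, hq]; ring, ← hp, ← hq]
  rw [← hp] at hD
  rw [← hq] at hE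
  rw [add_sub_add_left_eq_sub]
  field_simp
  ring

/-- Reflection in a half circle. -/
def circRefl (c r : ℝ) (hr : 0 < r) : UpperHalfPlane ≃ᵢ UpperHalfPlane :=
  mkIso (inv0 c r hr) (inv0 c r hr) (inv0_inv0 c r hr) (inv0_inv0 c r hr) (inv0_dist c r hr)

/-- The half circle. -/
def circLine (c r : ℝ) (hr : 0 < r) (t : ℝ) : UpperHalfPlane :=
  hpt (c + r * Real.sinh t / Real.cosh t) (r / Real.cosh t) (div_pos hr (Real.cosh_pos t))

lemma circLine_re (c r : ℝ) (hr : 0 < r) (t : ℝ) :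
    (circLine c r hr t).re = c + r * Real.sinh t / Real.cosh t := rfl

lemma circLine_im (c r : ℝ) (hr : 0 < r) (t : ℝ) :
    (circLine c r hr t).im = r / Real.cosh t := rfl

lemma circLine_eq (c r : ℝ) (hr : 0 < r) (t : ℝ) :
    ((circLine c r hr t).re - c) ^ 2 + (circLine c r hr t).im ^ 2 = r ^ 2 := by
  rw [circLine_re, circLine_im, add_sub_cancel_left]
  have := Real.cosh_pos t
  have h2 := Real.cosh_sq t
  field_simp
  linarith

lemma circLine_geod (c r : ℝ) (hr : 0 < r) : IsGeodesicOn (circLine c r hr) Set.univ := by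
  intro a _ b _
  refine aux_cosh_inj dist_nonneg (abs_nonneg _) ?_
  rw [Real.cosh_abs, cosh_dist_coord, circLine_re, circLine_re, circLine_im, circLine_im,
    Real.cosh_sub]
  have h1 := Real.cosh_pos a
  have h2 := Real.cosh_pos b
  have h3 := Real.cosh_sq a
  have h4 := Real.cosh_sq b
  rw [add_sub_add_left_eq_sub]
  field_simp
  linear_combination (-(Real.cosh b)^2) * h3 - (Real.cosh a)^2 * h4

lemma circRefl_isRefl (c r : ℝ) (hr : 0 < r) : IsReflAcross (circRefl c r hr) (circLine c r hr) := by
  refine ⟨fun h => ?_, ?_, fun t => ?_⟩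
  · have h1 := congrArg (fun e : UpperHalfPlane ≃ᵢ UpperHalfPlane =>
      (e (hpt c (2 * r) (by positivity))).im) h
    change r ^ 2 * (2 * r) / ((c - c) ^ 2 + (2 * r) ^ 2) = 2 * r at h1
    rw [sub_self] at h1
    field_simp at h1
    nlinarith [pow_pos hr 2]
  · ext1 z
    exact inv0_inv0 c r hr z
  · change inv0 c r hr _ = _
    have hE := circLine_eq c r hr t
    have hr2 : r ^ 2 ≠ 0 := by positivity
    apply UpperHalfPlane.ext_re_im
    · rw [inv0_re, hE]; field_simp; ring
    · rw [inv0_im, hE]; field_simp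

/-- The imaginary axis. -/
def vertLine (t : ℝ) : UpperHalfPlane := hpt 0 (Real.exp t) (Real.exp_pos t)

lemma vertLine_geod : IsGeodesicOn vertLine Set.univ := by
  intro a _ b _
  exact (UpperHalfPlane.isometry_vertical_line 0).dist_eq a b

/-- Reflection in the imaginary axis. -/
def vertRefl : UpperHalfPlane ≃ᵢ UpperHalfPlane :=
  mkIso (fun z => hpt (-z.re) z.im z.im_pos) (fun z => hpt (-z.re) z.im z.im_pos)
    (fun z => UpperHalfPlane.ext_re_im (neg_neg z.re) rfl)
    (fun z => UpperHalfPlane.ext_re_im (neg_neg z.re) rfl)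
    (fun z w => by
      rw [cosh_dist_coord, cosh_dist_coord]
      change ((-z.re - -w.re) ^ 2 + z.im ^ 2 + w.im ^ 2) / (2 * z.im * w.im) = _
      ring)

lemma vertRefl_isRefl : IsReflAcross vertRefl vertLine := by
  refine ⟨fun h => ?_, ?_, fun t => ?_⟩
  · have h1 := congrArg (fun e : UpperHalfPlane ≃ᵢ UpperHalfPlane =>
      (e (hpt 1 1 one_pos)).re) h
    change (-1 : ℝ) = 1 at h1
    norm_num at h1
  · ext1 z
    exact UpperHalfPlane.ext_re_im (neg_neg z.re) rfl
  · exact UpperHalfPlane.ext_re_im neg_zero rfl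

lemma vert_circ_ortho (r : ℝ) (hr : 0 < r) : PythOrtho vertLine (circLine 0 r hr) := by
  refine ⟨Real.log r, 0, fun a b => ?_⟩
  rw [cosh_dist_coord, circLine_re, circLine_im]
  change ((0 - (0 + r * Real.sinh (0 + b) / Real.cosh (0 + b))) ^ 2 + Real.exp (Real.log r + a) ^ 2
    + _) / (2 * Real.exp (Real.log r + a) * _) = _
  rw [Real.exp_add, Real.exp_log hr, zero_add, Real.cosh_eq a, Real.exp_neg]
  have h2 := Real.cosh_pos b
  have h4 := Real.cosh_sq b
  have := Real.exp_pos a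
  rw [zero_add]
  field_simp
  linear_combination (-r ^ 2) * h4

lemma circ_circ_ortho (c r c' r' : ℝ) (hr : 0 < r) (hr' : 0 < r') (hc : c < c')
    (h : (c' - c) ^ 2 = r ^ 2 + r' ^ 2) :
    PythOrtho (circLine c r hr) (circLine c' r' hr') := by
  have hD : 0 < c' - c := by linarith
  have key : ∀ x y : ℝ, 0 < x → 0 < y → (c' - c) ^ 2 = x ^ 2 + y ^ 2 →
      Real.cosh (Real.arsinh (x / y)) = (c' - c) / y := by
    intro x y _ hy h
    rw [Real.cosh_arsinh]
    have : 1 + (x / y) ^ 2 = ((c' - c) / y) ^ 2 := by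
      field_simp; linarith
    rw [this, Real.sqrt_sq (by positivity)]
  refine ⟨Real.arsinh (r / r'), -Real.arsinh (r' / r), fun a b => ?_⟩
  have e1 : Real.cosh a = ((c' - c) * Real.cosh (Real.arsinh (r / r') + a)
      - r * Real.sinh (Real.arsinh (r / r') + a)) / r' := by
    have : a = (Real.arsinh (r / r') + a) - Real.arsinh (r / r') := by ring
    conv_lhs => rw [this, Real.cosh_sub, Real.sinh_arsinh, key r r' hr hr' h]
    ring
  have e2 : Real.cosh b = ((c' - c) * Real.cosh (-Real.arsinh (r' / r) + b)
      + r' * Real.sinh (-Real.arsinh (r' / r) + b)) / r := by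
    have : b = (-Real.arsinh (r' / r) + b) + Real.arsinh (r' / r) := by ring
    conv_lhs => rw [this, Real.cosh_add, Real.sinh_arsinh, key r' r hr' hr (by linarith)]
    ring
  rw [e1, e2]
  generalize Real.arsinh (r / r') + a = u
  generalize -Real.arsinh (r' / r) + b = v
  rw [cosh_dist_coord, circLine_re, circLine_im, circLine_re, circLine_im]
  obtain ⟨D, hDe⟩ : ∃ D, D = c' - c := ⟨_, rfl⟩
  have hc' : c' = c + D := by rw [hDe]; ring
  rw [← hDe] at h
  subst hc'
  have h1 := Real.cosh_pos u
  have h2 := Real.cosh_pos v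
  have h3 := Real.cosh_sq u
  have h4 := Real.cosh_sq v
  generalize Real.cosh u = cu at *
  generalize Real.cosh v = cv at *
  generalize Real.sinh u = su at *
  generalize Real.sinh v = sv at *
  rw [show c + r * su / cu - (c + D + r' * sv / cv) = r * su / cu - r' * sv / cv - D by ring,
    show c + D - c = D by ring]
  have g1 : (r * su / cu) ^ 2 + (r / cu) ^ 2 = r ^ 2 := by
    field_simp; linarith
  have g2 : (r' * sv / cv) ^ 2 + (r' / cv) ^ 2 = r' ^ 2 := by
    field_simp; linarith
  have g3 : (r * su / cu - r' * sv / cv - D) ^ 2 + (r / cu) ^ 2 + (r' / cv) ^ 2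
      = 2 * (D ^ 2 - r * su / cu * (r' * sv / cv) - D * (r * su / cu) + D * (r' * sv / cv)) := by
    linear_combination g1 + g2 - h
  rw [g3]
  field_simp
  ring

lemma circ_circ_disj (c r c' r' : ℝ) (hr : 0 < r) (hr' : 0 < r')
    (h : 4 * (c' - c) ^ 2 * r ^ 2 < ((c' - c) ^ 2 + r ^ 2 - r' ^ 2) ^ 2) :
    DisjLines (circLine c r hr) (circLine c' r' hr') := by
  unfold DisjLines
  rw [Set.eq_empty_iff_forall_notMem]
  rintro z ⟨⟨a, rfl⟩, ⟨b, hb⟩⟩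
  have h1 := circLine_eq c r hr a
  have h2 := circLine_eq c' r' hr' b
  rw [hb] at h2
  generalize (circLine c r hr a).re = x at *
  generalize (circLine c r hr a).im = y at *
  have h3 : (c' - c) ^ 2 + r ^ 2 - r' ^ 2 = 2 * (c' - c) * (x - c) := by
    linear_combination h2 - h1
  rw [h3] at h
  nlinarith [mul_nonneg (sq_nonneg (c' - c)) (sq_nonneg y)]

lemma vert_circ_disj (c r : ℝ) (hr : 0 < r) (h : r ^ 2 < c ^ 2) :
    DisjLines vertLine (circLine c r hr) := by
  unfold DisjLines
  rw [Set.eq_empty_iff_forall_notMem]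
  rintro z ⟨⟨a, rfl⟩, ⟨b, hb⟩⟩
  have h2 := circLine_eq c r hr b
  rw [hb] at h2
  change (0 - c) ^ 2 + Real.exp a ^ 2 = r ^ 2 at h2
  nlinarith [sq_nonneg (Real.exp a)]

lemma DisjLines.symm' {γ σ : ℝ → UpperHalfPlane} (h : DisjLines γ σ) : DisjLines σ γ := by
  unfold DisjLines at *
  rwa [Set.inter_comm]

lemma DisjLines.range_ne {γ σ : ℝ → UpperHalfPlane} (h : DisjLines γ σ) :
    Set.range γ ≠ Set.range σ := by
  intro he
  unfold DisjLines at h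
  rw [← he, Set.inter_self] at h
  exact (Set.range_nonempty γ).ne_empty h

/-! ### Dilations -/

/-- The dilation by `exp x`. -/
def dil (x : ℝ) : UpperHalfPlane ≃ᵢ UpperHalfPlane :=
  mkIso (fun z => hpt (Real.exp x * z.re) (Real.exp x * z.im) (mul_pos (Real.exp_pos x) z.im_pos))
    (fun z => hpt (Real.exp (-x) * z.re) (Real.exp (-x) * z.im)
      (mul_pos (Real.exp_pos _) z.im_pos))
    (fun z => by
      apply UpperHalfPlane.ext_re_im
      · change Real.exp x * (Real.exp (-x) * z.re) = z.re
        rw [← mul_assoc, ← Real.exp_add]; simp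
      · change Real.exp x * (Real.exp (-x) * z.im) = z.im
        rw [← mul_assoc, ← Real.exp_add]; simp)
    (fun z => by
      apply UpperHalfPlane.ext_re_im
      · change Real.exp (-x) * (Real.exp x * z.re) = z.re
        rw [← mul_assoc, ← Real.exp_add]; simp
      · change Real.exp (-x) * (Real.exp x * z.im) = z.im
        rw [← mul_assoc, ← Real.exp_add]; simp)
    (fun z w => by
      rw [cosh_dist_coord, cosh_dist_coord]
      change ((Real.exp x * z.re - Real.exp x * w.re) ^ 2 + (Real.exp x * z.im) ^ 2
        + (Real.exp x * w.im) ^ 2) / (2 * (Real.exp x * z.im) * (Real.exp x * w.im)) = _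
      have := Real.exp_pos x
      have := z.im_pos
      have := w.im_pos
      field_simp)

lemma dil_re (x : ℝ) (z : UpperHalfPlane) : (dil x z).re = Real.exp x * z.re := rfl
lemma dil_im (x : ℝ) (z : UpperHalfPlane) : (dil x z).im = Real.exp x * z.im := rfl

lemma dil_add (x y : ℝ) : dil (x + y) = dil x * dil y := by
  ext1 z
  apply UpperHalfPlane.ext_re_im
  · change Real.exp (x + y) * z.re = Real.exp x * (Real.exp y * z.re)
    rw [Real.exp_add, mul_assoc]
  · change Real.exp (x + y) * z.im = Real.exp x * (Real.exp y * z.im)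
    rw [Real.exp_add, mul_assoc]

lemma dil_zero : dil 0 = 1 := by
  ext1 z
  apply UpperHalfPlane.ext_re_im
  · rw [dil_re, Real.exp_zero, one_mul]; rfl
  · rw [dil_im, Real.exp_zero, one_mul]; rfl

lemma dil_neg (x : ℝ) : dil (-x) = (dil x)⁻¹ := by
  rw [eq_inv_iff_mul_eq_one, ← dil_add, neg_add_cancel, dil_zero]

lemma dil_ne_one {x : ℝ} (hx : x ≠ 0) : dil x ≠ 1 := by
  intro h
  have h1 := congrArg (fun e : UpperHalfPlane ≃ᵢ UpperHalfPlane =>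
      (e (hpt 1 1 one_pos)).re) h
  change Real.exp x * 1 = 1 at h1
  rw [mul_one, Real.exp_eq_one_iff] at h1
  exact hx h1

lemma refl_mul_refl (r q : ℝ) (hr : 0 < r) (hq : 0 < q) :
    circRefl 0 r hr * circRefl 0 q hq = dil (Real.log (r ^ 2 / q ^ 2)) := by
  ext1 z
  change inv0 0 r hr (inv0 0 q hq z) = _
  have hD := circ_den_pos 0 z
  have hy := z.im_pos
  have key : (q ^ 2 * (z.re - 0) / ((z.re - 0) ^ 2 + z.im ^ 2)) ^ 2 +
      (q ^ 2 * z.im / ((z.re - 0) ^ 2 + z.im ^ 2)) ^ 2 = q ^ 4 / ((z.re - 0) ^ 2 + z.im ^ 2) := by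
    field_simp
  apply UpperHalfPlane.ext_re_im
  · rw [inv0_re, inv0_re, inv0_im, add_sub_cancel_left, key, dil_re, Real.exp_log (by positivity)]
    field_simp
    ring
  · rw [inv0_im, inv0_re, inv0_im, add_sub_cancel_left, key, dil_im, Real.exp_log (by positivity)]
    field_simp

lemma dil_dist_tendsto (z : UpperHalfPlane) :
    Filter.Tendsto (fun x => dist (dil x z) z) (nhds 0) (nhds 0) := by
  have hc : Continuous fun x => dist (dil x z) z := by
    refine Continuous.dist ?_ continuous_const
    rw [UpperHalfPlane.isEmbedding_coe.continuous_iff]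
    have : (UpperHalfPlane.coe ∘ fun x => dil x z) = fun x : ℝ => (Real.exp x : ℂ) * (z : ℂ) := by
      funext x
      apply Complex.ext
      · rw [Complex.re_ofReal_mul]; rfl
      · rw [Complex.im_ofReal_mul]; rfl
    rw [this]
    fun_prop
  have := hc.tendsto 0
  rw [dil_zero] at this
  have h1 : dist ((1 : UpperHalfPlane ≃ᵢ UpperHalfPlane) z) z = 0 := dist_self z
  rwa [h1] at this

lemma irrational_logs : Irrational (Real.log 4 / Real.log 9) := by
  have h9 : 0 < Real.log 9 := Real.log_pos (by norm_num)
  have h4 : 0 < Real.log 4 := Real.log_pos (by norm_num)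
  rw [irrational_iff_ne_rational]
  intro a b hb h
  rw [div_eq_div_iff h9.ne' (by exact_mod_cast hb)] at h
  have h' : (b.natAbs : ℝ) * Real.log 4 = (a.natAbs : ℝ) * Real.log 9 := by
    have := congrArg abs h
    rw [abs_mul, abs_mul, abs_of_pos h4, abs_of_pos h9] at this
    rw [Nat.cast_natAbs, Nat.cast_natAbs, Int.cast_abs, Int.cast_abs]
    linarith
  rw [← Real.log_pow, ← Real.log_pow] at h'
  have h2 : (4 : ℝ) ^ b.natAbs = 9 ^ a.natAbs :=
    Real.log_injOn_pos (Set.mem_Ioi.2 (by positivity)) (Set.mem_Ioi.2 (by positivity)) h'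
  have h3 : 4 ^ b.natAbs = 9 ^ a.natAbs := by exact_mod_cast h2
  have h5 : Even (4 ^ b.natAbs) := (Nat.even_pow.2 ⟨by decide, by simpa using hb⟩)
  rw [h3] at h5
  exact absurd (Nat.even_pow.1 h5).1 (by decide)

lemma dil_nondiscrete (G : Subgroup (UpperHalfPlane ≃ᵢ UpperHalfPlane))
    (h4 : dil (Real.log 4) ∈ G) (h9 : dil (Real.log 9) ∈ G) (ε : ℝ) (hε : 0 < ε)
    (s : Set UpperHalfPlane) (hs : s.Finite) :
    ∃ g ∈ G, g ≠ 1 ∧ ∀ z ∈ s, dist (g z) z < ε := by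
  have hdense := dense_addSubgroupClosure_pair_iff.2 irrational_logs
  have hmem : ∀ x ∈ AddSubgroup.closure {Real.log 4, Real.log 9}, dil x ∈ G := by
    intro x hx
    induction hx using AddSubgroup.closure_induction with
    | mem x hx =>
      rcases hx with rfl | rfl
      · exact h4
      · exact h9
    | zero => rw [dil_zero]; exact G.one_mem
    | add x y _ _ hx hy => rw [dil_add]; exact G.mul_mem hx hy
    | neg x _ hx => rw [dil_neg]; exact G.inv_mem hx
  have hev : ∀ᶠ x in nhds (0 : ℝ), ∀ z ∈ s, dist (dil x z) z < ε :=
    (Filter.eventually_all_finite hs).2 fun z _ => (dil_dist_tendsto z).eventually_lt_const hε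
  obtain ⟨δ, hδ, hb⟩ := Metric.eventually_nhds_iff.1 hev
  obtain ⟨x, hx, hxm⟩ := hdense.exists_mem_open (isOpen_Ioo (a := (0:ℝ)) (b := δ))
    ⟨δ / 2, by constructor <;> linarith⟩
  obtain ⟨hx, hxm⟩ : x ∈ AddSubgroup.closure {Real.log 4, Real.log 9} ∧ x ∈ Set.Ioo 0 δ := ⟨hx, hxm⟩
  refine ⟨dil x, hmem x hx, dil_ne_one hxm.1.ne', hb ?_⟩
  rw [Real.dist_eq, sub_zero, abs_of_pos hxm.1]
  exact hxm.2

/-- There are six distinct geodesic lines in the hyperbolic plane,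
`γ₀,…,γ₄` forming a right-angled pentagon (consecutive lines orthogonal, non-consecutive
disjoint) and `γ₅` meeting `γ₀` orthogonally and disjoint from `γ₁,…,γ₄`, such that the
group generated by the reflections across the six lines is not discrete (arbitrarily
close to the identity there are nontrivial elements, uniformly on finite sets). -/
theorem hyperbolic_nondiscrete_reflection_configuration :
    ∃ (γ : Fin 6 → ℝ → UpperHalfPlane) (ρ : Fin 6 → (UpperHalfPlane ≃ᵢ UpperHalfPlane)),
      (∀ i, IsGeodesicOn (γ i) Set.univ) ∧
      (∀ i, IsReflAcross (ρ i) (γ i)) ∧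
      (∀ i j, i ≠ j → Set.range (γ i) ≠ Set.range (γ j)) ∧
      (∀ i : Fin 5, MeetOrtho (γ (pent i)) (γ (pent (i + 1)))) ∧
      (∀ i j : Fin 5, i ≠ j → j ≠ i + 1 → i ≠ j + 1 →
        DisjLines (γ (pent i)) (γ (pent j))) ∧
      MeetOrtho (γ 5) (γ 0) ∧
      (∀ i : Fin 5, i ≠ 0 → DisjLines (γ 5) (γ (pent i))) ∧
      (∀ ε > 0, ∀ s : Set UpperHalfPlane, s.Finite →
        ∃ g ∈ Subgroup.closure (Set.range ρ),
          g ≠ (1 : UpperHalfPlane ≃ᵢ UpperHalfPlane) ∧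
          ∀ z ∈ s, dist (g z) z < ε) := by
  have h5 : √5 ^ 2 = (5:ℝ) := Real.sq_sqrt (by norm_num)
  have h50 : 0 < √(5:ℝ) := Real.sqrt_pos.2 (by norm_num)
  have p1 : (0:ℝ) < 1 := one_pos
  have p2 : (0:ℝ) < 1 / 2 := by norm_num
  have p4 : (0:ℝ) < 2 := two_pos
  have p6 : (0:ℝ) < 6 := by norm_num
  let γ : Fin 6 → ℝ → UpperHalfPlane := ![vertLine, circLine 0 1 p1, circLine (√5 / 2) (1 / 2) p2,
    circLine √5 1 p1, circLine 0 2 p4, circLine 0 6 p6]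
  let ρ : Fin 6 → (UpperHalfPlane ≃ᵢ UpperHalfPlane) := ![vertRefl, circRefl 0 1 p1,
    circRefl (√5 / 2) (1 / 2) p2, circRefl √5 1 p1, circRefl 0 2 p4, circRefl 0 6 p6]
  have hgeo : ∀ i, IsGeodesicOn (γ i) Set.univ := by
    intro i
    fin_cases i
    · exact vertLine_geod
    · exact circLine_geod 0 1 p1
    · exact circLine_geod (√5 / 2) (1 / 2) p2
    · exact circLine_geod √5 1 p1
    · exact circLine_geod 0 2 p4
    · exact circLine_geod 0 6 p6
  have o01 : PythOrtho (γ 0) (γ 1) := vert_circ_ortho 1 p1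
  have o04 : PythOrtho (γ 0) (γ 4) := vert_circ_ortho 2 p4
  have o05 : PythOrtho (γ 0) (γ 5) := vert_circ_ortho 6 p6
  have o12 : PythOrtho (γ 1) (γ 2) := circ_circ_ortho 0 1 (√5 / 2) (1 / 2) p1 p2 (by linarith) (by nlinarith)
  have o23 : PythOrtho (γ 2) (γ 3) := circ_circ_ortho (√5 / 2) (1 / 2) √5 1 p2 p1 (by linarith) (by nlinarith)
  have o43 : PythOrtho (γ 4) (γ 3) := circ_circ_ortho 0 2 √5 1 p4 p1 (by linarith) (by nlinarith)
  have q5 : (√5 / 2) ^ 2 = (5 / 4 : ℝ) := by rw [div_pow, h5]; norm_num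
  have d02 : DisjLines (γ 0) (γ 2) := vert_circ_disj (√5 / 2) (1 / 2) p2 (by rw [q5]; norm_num)
  have d03 : DisjLines (γ 0) (γ 3) := vert_circ_disj √5 1 p1 (by rw [h5]; norm_num)
  have d13 : DisjLines (γ 1) (γ 3) := circ_circ_disj 0 1 √5 1 p1 p1 (by rw [sub_zero, h5]; norm_num)
  have d14 : DisjLines (γ 1) (γ 4) := circ_circ_disj 0 1 0 2 p1 p4 (by norm_num)
  have d42 : DisjLines (γ 4) (γ 2) := circ_circ_disj 0 2 (√5 / 2) (1 / 2) p4 p2 (by rw [sub_zero, q5]; norm_num)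
  have d51 : DisjLines (γ 5) (γ 1) := circ_circ_disj 0 6 0 1 p6 p1 (by norm_num)
  have d52 : DisjLines (γ 5) (γ 2) := circ_circ_disj 0 6 (√5 / 2) (1 / 2) p6 p2 (by rw [sub_zero, q5]; norm_num)
  have d53 : DisjLines (γ 5) (γ 3) := circ_circ_disj 0 6 √5 1 p6 p1 (by rw [sub_zero, h5]; norm_num)
  have d54 : DisjLines (γ 5) (γ 4) := circ_circ_disj 0 6 0 2 p6 p4 (by norm_num)
  refine ⟨γ, ρ, hgeo, ?_, ?_, ?_, ?_, ?_, ?_, ?_⟩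
  · intro i
    fin_cases i
    · exact vertRefl_isRefl
    · exact circRefl_isRefl 0 1 p1
    · exact circRefl_isRefl (√5 / 2) (1 / 2) p2
    · exact circRefl_isRefl √5 1 p1
    · exact circRefl_isRefl 0 2 p4
    · exact circRefl_isRefl 0 6 p6
  · have hlt : ∀ i j : Fin 6, i < j → Set.range (γ i) ≠ Set.range (γ j) := by
      intro i j hij
      fin_cases i <;> fin_cases j <;> first
        | exact absurd hij (by decide)
        | exact o01.range_ne
        | exact o04.range_ne
        | exact o05.range_ne
        | exact o12.range_ne
        | exact o23.range_ne
        | exact o43.symm.range_ne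
        | exact d02.range_ne
        | exact d03.range_ne
        | exact d13.range_ne
        | exact d14.range_ne
        | exact d42.symm'.range_ne
        | exact d51.symm'.range_ne
        | exact d52.symm'.range_ne
        | exact d53.symm'.range_ne
        | exact d54.symm'.range_ne
    intro i j hij
    rcases lt_or_gt_of_ne hij with h | h
    · exact hlt i j h
    · exact (hlt j i h).symm
  · intro i
    fin_cases i
    · exact o01.meetOrtho (hgeo 0) (hgeo 1)
    · exact o12.meetOrtho (hgeo 1) (hgeo 2)
    · exact o23.meetOrtho (hgeo 2) (hgeo 3)
    · exact o43.symm.meetOrtho (hgeo 3) (hgeo 4)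
    · exact o04.symm.meetOrtho (hgeo 4) (hgeo 0)
  · intro i j h1 h2 h3
    fin_cases i <;> fin_cases j <;> first
      | exact absurd rfl h1
      | exact absurd rfl h2
      | exact absurd rfl h3
      | exact d02
      | exact d02.symm'
      | exact d03
      | exact d03.symm'
      | exact d13
      | exact d13.symm'
      | exact d14
      | exact d14.symm'
      | exact d42
      | exact d42.symm'
  · exact o05.symm.meetOrtho (hgeo 5) (hgeo 0)
  · intro i hi
    fin_cases i
    · exact absurd rfl hi
    · exact d51
    · exact d52
    · exact d53
    · exact d54
  · intro ε hε s hs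
    have hm : ∀ i, ρ i ∈ Subgroup.closure (Set.range ρ) :=
      fun i => Subgroup.subset_closure ⟨i, rfl⟩
    refine dil_nondiscrete _ ?_ ?_ ε hε s hs
    · have h := refl_mul_refl 2 1 p4 p1
      rw [show (2:ℝ) ^ 2 / 1 ^ 2 = 4 by norm_num] at h
      rw [← h]
      exact Subgroup.mul_mem _ (hm 4) (hm 1)
    · have h := refl_mul_refl 6 2 p6 p4
      rw [show (6:ℝ) ^ 2 / 2 ^ 2 = 9 by norm_num] at h
      rw [← h]
      exact Subgroup.mul_mem _ (hm 5) (hm 4)
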